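/- arXiv:1809.04417 — 2 statements merged into one kernel-verified Lean document; each statement's English description precedes it below -/
import Mathlib

section
/- Let G be a finite group and let μ : G → ℝ be a probability distribution on G (μ(g) ≥ 0 for all g and Σ_{g∈G} μ(g) = 1) which is infinitely divisible: for every positive integer n there exists a probability distribution μ_n on G whose n-fold convolution power equals μ. Then μ is of Poisson type: there exist a subgroup H of G, a real number r ≥ 0, and a probability distribution ν on G that is H-bi-invariant (φ_H ⋆ ν = ν ⋆ φ_H = ν, where φ_H is the uniform distribution on H), such that μ = e^{−r} · Σ_{k=0}^{∞} (r^k / k!) ν^{⋆k}, where ν^{⋆0} := φ_H and ν^{⋆k} denotes the k-fold convolution power of ν. -/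
open scoped Classical

/-- Convolution of two functions on a finite group:
`(μ ⋆ ν)(g) = Σ_{h∈G} μ(h) ν(h⁻¹g)`. -/
noncomputable def conv {G : Type*} [Group G] [Fintype G] (μ ν : G → ℝ) : G → ℝ :=
  fun g => ∑ h : G, μ h * ν (h⁻¹ * g)

/-- The `n`-fold convolution power `ν^{⋆n}` of `ν` (with `ν^{⋆0}` the Dirac mass at the
identity, which is the unit for convolution; we only use `n ≥ 1`). -/
noncomputable def convNPow {G : Type*} [Group G] [Fintype G] (ν : G → ℝ) : ℕ → G → ℝ
  | 0 => fun g => if g = 1 then 1 else 0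
  | n + 1 => conv ν (convNPow ν n)

/-- Convolution powers of `ν` with base point `φ`: `ν^{⋆0} := φ`,
`ν^{⋆(k+1)} := ν^{⋆k} ⋆ ν`. -/
noncomputable def convPowFrom {G : Type*} [Group G] [Fintype G] (φ ν : G → ℝ) : ℕ → G → ℝ
  | 0 => φ
  | k + 1 => conv (convPowFrom φ ν k) ν

/-- The uniform probability distribution `φ_H` on a subgroup `H` of a finite group `G`. -/
noncomputable def uniformOn {G : Type*} [Group G] [Fintype G] (H : Subgroup G) : G → ℝ :=
  fun g => if g ∈ H then 1 / (Nat.card H : ℝ) else 0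

open Filter Topology

section Helpers

set_option linter.unusedSectionVars false

variable {G : Type*} [Group G] [Fintype G]

/-- The matrix of left convolution by `f`. -/
noncomputable def Lm (f : G → ℝ) : Matrix G G ℝ := fun g h => f (g * h⁻¹)

lemma Lm_conv (f f' : G → ℝ) : Lm (conv f f') = Lm f * Lm f' := by
  ext g h
  simp only [Lm, conv, Matrix.mul_apply]
  refine Fintype.sum_equiv ((Equiv.inv G).trans (Equiv.mulRight g)) _ _ ?_
  intro a
  simp [mul_assoc]

lemma Lm_injective : Function.Injective (Lm : (G → ℝ) → Matrix G G ℝ) := by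
  intro f f' h
  ext g
  have := congrFun (congrFun h g) 1
  simpa [Lm] using this

lemma Lm_one : Lm (fun g : G => if g = 1 then (1 : ℝ) else 0) = 1 := by
  ext g h
  simp [Lm, Matrix.one_apply, mul_inv_eq_one]

lemma Lm_convNPow (f : G → ℝ) (n : ℕ) : Lm (convNPow f n) = Lm f ^ n := by
  induction n with
  | zero => simp only [convNPow, pow_zero]; exact Lm_one
  | succ n ih => rw [convNPow, Lm_conv, ih, pow_succ']

lemma Lm_convPowFrom (p f : G → ℝ) (n : ℕ) : Lm (convPowFrom p f n) = Lm p * Lm f ^ n := by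
  induction n with
  | zero => simp [convPowFrom]
  | succ n ih => rw [convPowFrom, Lm_conv, ih, pow_succ, mul_assoc]

/-- Convolution matrices of probability distributions. -/
def PM (G : Type*) [Group G] [Fintype G] : Set (Matrix G G ℝ) := Lm '' stdSimplex ℝ G

lemma Lm_continuous : Continuous (Lm : (G → ℝ) → Matrix G G ℝ) := by
  refine continuous_matrix fun i j => ?_
  simp only [Lm]
  fun_prop

instance matFC {n : Type*} [Fintype n] : FirstCountableTopology (Matrix n n ℝ) :=
  inferInstanceAs (FirstCountableTopology (n → n → ℝ))

lemma PM_compact : IsCompact (PM G) := (isCompact_stdSimplex ℝ G).image Lm_continuous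

lemma PM_one : (1 : Matrix G G ℝ) ∈ PM G := by
  refine ⟨_, ⟨fun g => ?_, ?_⟩, Lm_one⟩
  · split_ifs <;> norm_num
  · simp

lemma PM_mul {x y : Matrix G G ℝ} (hx : x ∈ PM G) (hy : y ∈ PM G) : x * y ∈ PM G := by
  obtain ⟨f, ⟨hf0, hf1⟩, rfl⟩ := hx
  obtain ⟨f', ⟨hf0', hf1'⟩, rfl⟩ := hy
  refine ⟨conv f f', ⟨fun g => Finset.sum_nonneg fun h _ => mul_nonneg (hf0 _) (hf0' _), ?_⟩,
    Lm_conv _ _⟩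
  simp only [conv]
  rw [Finset.sum_comm]
  have : ∀ h : G, ∑ g, f h * f' (h⁻¹ * g) = f h := by
    intro h
    have h3 : ∑ g, f' (h⁻¹ * g) = ∑ g, f' g :=
      Fintype.sum_equiv (Equiv.mulLeft h⁻¹) _ f' (fun _ => rfl)
    rw [← Finset.mul_sum, h3, hf1', mul_one]
  simp [this, hf1]

lemma PM_pow {x : Matrix G G ℝ} (hx : x ∈ PM G) (n : ℕ) : x ^ n ∈ PM G := by
  induction n with
  | zero => simpa using PM_one
  | succ n ih => rw [pow_succ]; exact PM_mul ih hx

lemma fitting {n : Type*} [Fintype n] (M : Matrix n n ℝ) :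
    ∃ e b : Matrix n n ℝ, ∃ k : ℕ, e * e = e ∧ (∀ X, Commute X M → Commute X e) ∧
      M ^ k * (1 - e) = 0 ∧ M * b = e ∧ b * e = e * b := by
  have hp : M.charpoly ≠ 0 := M.charpoly_monic.ne_zero
  obtain ⟨q, hq, hq0⟩ := Polynomial.exists_eq_pow_rootMultiplicity_mul_and_not_dvd _ hp 0
  generalize M.charpoly.rootMultiplicity 0 = k at hq
  simp only [map_zero, sub_zero] at hq hq0
  have hcop : IsCoprime (Polynomial.X ^ (k+1)) q :=
    IsCoprime.pow_left ((Polynomial.irreducible_X.coprime_iff_not_dvd).2 hq0)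
  obtain ⟨a, c, hac⟩ := hcop
  have hz : Polynomial.aeval M (Polynomial.X ^ (k+1) * q) = 0 := by
    rw [pow_succ', mul_assoc, ← hq, map_mul, M.aeval_self_charpoly, mul_zero]
  have h1 : Polynomial.aeval M (a * Polynomial.X ^ (k+1)) = 1 - Polynomial.aeval M (c * q) := by
    rw [eq_sub_iff_add_eq, ← map_add, hac, map_one]
  have key : M ^ (k+1) * (1 - Polynomial.aeval M (a * Polynomial.X ^ (k+1))) = 0 := by
    rw [h1, sub_sub_cancel]
    have : M ^ (k+1) * Polynomial.aeval M (c * q) =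
        Polynomial.aeval M c * Polynomial.aeval M (Polynomial.X ^ (k+1) * q) := by
      rw [← map_mul, show c * (Polynomial.X ^ (k+1) * q) = Polynomial.X ^ (k+1) * (c * q) by ring,
        map_mul (Polynomial.aeval M) (Polynomial.X ^ (k+1)), map_pow, Polynomial.aeval_X]
    rw [this, hz, mul_zero]
  refine ⟨Polynomial.aeval M (a * Polynomial.X ^ (k+1)), Polynomial.aeval M (a * Polynomial.X ^ k),
    k + 1, ?_, ?_, key, ?_, ?_⟩
  · have h2 : Polynomial.aeval M (a * Polynomial.X ^ (k+1)) *
        (1 - Polynomial.aeval M (a * Polynomial.X ^ (k+1))) = 0 := by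
      conv_lhs => rw [map_mul, map_pow, Polynomial.aeval_X, mul_assoc]
      rw [map_mul, map_pow, Polynomial.aeval_X] at key
      rw [key, mul_zero]
    rw [mul_sub, mul_one, sub_eq_zero] at h2
    exact h2.symm
  · intro X hX
    generalize a * Polynomial.X ^ (k+1) = p
    induction p using Polynomial.induction_on' with
    | add p q hp hq => rw [map_add]; exact hp.add_right hq
    | monomial n c =>
      rw [Polynomial.aeval_monomial]
      exact (Algebra.commute_algebraMap_right c X).mul_right (hX.pow_right n)
  · have : Polynomial.aeval M (Polynomial.X * (a * Polynomial.X ^ k)) =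
        M * Polynomial.aeval M (a * Polynomial.X ^ k) := by
      rw [map_mul, Polynomial.aeval_X]
    rw [← this]
    congr 1; ring
  · rw [← map_mul, ← map_mul, mul_comm]

lemma nil_bound {n : Type*} [Fintype n] (X : Matrix n n ℝ) (m : ℕ) (h : X ^ m = 0) :
    X ^ Fintype.card n = 0 := by
  have h2 : (Matrix.toLin' X) ^ (m + Fintype.card n) = 0 := by
    rw [← Matrix.toLin'_pow, pow_add, h, zero_mul, map_zero]
  have := Module.End.ker_pow_eq_ker_pow_finrank_of_le (f := Matrix.toLin' X)
    (m := m + Fintype.card n) (by simp)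
  rw [h2, LinearMap.ker_zero, Module.finrank_fintype_fun_eq_card, eq_comm, LinearMap.ker_eq_top,
    ← Matrix.toLin'_pow] at this
  exact (LinearEquiv.map_eq_zero_iff _).1 this

lemma roots (μ : G → ℝ)
    (hdiv : ∀ n : ℕ, 0 < n →
      ∃ ν : G → ℝ, (∀ g, 0 ≤ ν g) ∧ (∑ g, ν g = 1) ∧ convNPow ν n = μ) :
    ∃ e : Matrix G G ℝ, e * e = e ∧ (1 - e + Lm μ).det ≠ 0 ∧
      ∀ n : ℕ, 0 < n → ∃ x ∈ PM G, x ^ n = Lm μ ∧ x * e = x ∧ e * x = x := by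
  obtain ⟨e, b, k, hee, hcom, hk, hMb, hbe⟩ := fitting (Lm μ)
  have hx : ∀ n : ℕ, 0 < n → ∃ x ∈ PM G, x ^ n = Lm μ ∧ x * e = x ∧ e * x = x := by
    intro n hn
    obtain ⟨ν, h0, h1, h2⟩ := hdiv (Fintype.card G * n) (Nat.mul_pos Fintype.card_pos hn)
    have h3 : Lm ν ^ (Fintype.card G * n) = Lm μ := by rw [← Lm_convNPow, h2]
    have hce : Commute (Lm ν) e := hcom _ (by rw [← h3]; exact Commute.self_pow _ _)
    have hce' : Commute (Lm ν) (1 - e) := (Commute.one_right _).sub_right hce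
    have hid : IsIdempotentElem (1 - e) := IsIdempotentElem.one_sub hee
    have hnil : (Lm ν * (1 - e)) ^ (Fintype.card G * n * (k + 1)) = 0 := by
      rw [hce'.mul_pow, pow_mul, h3, hid.pow_eq (by positivity), pow_succ', mul_assoc, hk, mul_zero]
    have h5 := nil_bound _ _ hnil
    rw [hce'.mul_pow, hid.pow_eq Fintype.card_ne_zero, mul_sub, mul_one, sub_eq_zero] at h5
    refine ⟨Lm ν ^ Fintype.card G, PM_pow ⟨ν, ⟨h0, h1⟩, rfl⟩ _, by rw [← pow_mul, h3], h5.symm, ?_⟩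
    rw [← (hce.pow_left _).eq]; exact h5.symm
  refine ⟨e, hee, ?_, hx⟩
  obtain ⟨x, -, hx1, hx2, hx3⟩ := hx 1 one_pos
  rw [pow_one] at hx1
  subst hx1
  have : (1 - e + Lm μ) * (1 - e + e * b) = 1 := by
    have h1 : e * (e * b) = e * b := by rw [← mul_assoc, hee]
    have h2 : Lm μ * (e * b) = e := by rw [← mul_assoc, hx2, hMb]
    simp only [add_mul, sub_mul, mul_add, mul_sub, one_mul, mul_one, hee, h1, h2, hx2]
    abel
  intro h0
  have := congrArg Matrix.det this
  rw [Matrix.det_mul, h0] at this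
  simp at this

lemma one_sub_add_pow {n : Type*} [Fintype n] {e x : Matrix n n ℝ} (hee : e * e = e)
    (h1 : x * e = x) (h2 : e * x = x) {k : ℕ} (hk : 0 < k) :
    (1 - e + x) ^ k = 1 - e + x ^ k := by
  induction k, hk using Nat.le_induction with
  | base => simp
  | succ k hk ih =>
    obtain ⟨j, rfl⟩ : ∃ j, k = j + 1 := ⟨k - 1, by omega⟩
    have h3 : x ^ (j+1) * e = x ^ (j+1) := by rw [pow_succ, mul_assoc, h1]
    rw [pow_succ, ih, pow_succ x (j+1)]
    simp only [add_mul, sub_mul, mul_add, mul_sub, one_mul, mul_one, hee, h2, h3]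
    abel

lemma limit_inv {e x : Matrix G G ℝ} (hee : e * e = e) (hx : x ∈ PM G)
    (h1 : x * e = x) (h2 : e * x = x) (hd : |(1 - e + x).det| = 1) :
    ∃ y ∈ PM G, x * y = e := by
  obtain ⟨s, hs, ψ, hψ, hlim⟩ := PM_compact.tendsto_subseq (fun k : ℕ => PM_pow hx (k+1))
  obtain ⟨y, hy, θ, hθ, hlim2⟩ := PM_compact.tendsto_subseq
    (fun j : ℕ => PM_pow hx (ψ (j+1) - ψ j - 1))
  refine ⟨y, hy, ?_⟩
  have hse : s * e = s := by
    refine tendsto_nhds_unique ?_ hlim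
    refine (hlim.mul_const e).congr fun j => ?_
    simp only [Function.comp]
    rw [pow_succ, mul_assoc, h1]
  have hdet : |(1 - e + s).det| = 1 := by
    have hc : Continuous fun m : Matrix G G ℝ => |(1 - e + m).det| := by
      refine continuous_abs.comp (Continuous.matrix_det ?_)
      fun_prop
    refine tendsto_nhds_unique ((hc.tendsto s).comp hlim) ?_
    refine tendsto_const_nhds.congr fun j => ?_
    simp only [Function.comp]
    rw [← one_sub_add_pow hee h1 h2 (Nat.succ_pos _), Matrix.det_pow, abs_pow, hd, one_pow]
  have hsxy : s * x * y = s := by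
    have ha : Tendsto (fun j => x ^ (ψ (θ j) + 1)) atTop (𝓝 s) := hlim.comp hθ.tendsto_atTop
    have hb : Tendsto (fun j => x ^ (ψ (θ j + 1) + 1)) atTop (𝓝 s) :=
      hlim.comp ((tendsto_add_atTop_nat 1).comp hθ.tendsto_atTop)
    refine tendsto_nhds_unique ?_ hb
    refine ((ha.mul_const x).mul hlim2).congr fun j => ?_
    simp only [Function.comp]
    rw [← pow_succ, ← pow_add]
    congr 1
    have := hψ (Nat.lt_succ_self (θ j))
    simp only [Nat.succ_eq_add_one] at this
    omega
  have hz : (1 - e + s) * (e - x * y) = 0 := by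
    have h3 : e * (x * y) = x * y := by rw [← mul_assoc, h2]
    have h4 : s * (x * y) = s := by rw [← mul_assoc, hsxy]
    simp only [add_mul, sub_mul, mul_sub, one_mul, hee, h3, h4, hse]
    abel
  have hu : IsUnit (1 - e + s) := by
    rw [Matrix.isUnit_iff_isUnit_det, isUnit_iff_ne_zero]
    intro h; rw [h] at hdet; simp at hdet
  have := hu.mul_right_eq_zero.1 hz
  exact (sub_eq_zero.1 this).symm

lemma idem_uniform {f : G → ℝ} (hf : f ∈ stdSimplex ℝ G) (h : conv f f = f) :
    ∃ H : Subgroup G, f = uniformOn H := by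
  obtain ⟨h0, h1⟩ := hf
  have hmul : ∀ a b, 0 < f a → 0 < f b → 0 < f (a * b) := by
    intro a b ha hb
    rw [← h]
    refine lt_of_lt_of_le (mul_pos ha hb) ?_
    have := Finset.single_le_sum (f := fun k => f k * f (k⁻¹ * (a * b)))
      (fun k _ => mul_nonneg (h0 _) (h0 _)) (Finset.mem_univ a)
    simpa [conv] using this
  obtain ⟨g0, hg0⟩ := Finite.exists_max f
  have hpos : 0 < f g0 := by
    by_contra hn
    have : ∀ g, f g = 0 := fun g => le_antisymm ((hg0 g).trans (not_lt.1 hn)) (h0 g)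
    simp [this] at h1
  have hmax : ∀ a, 0 < f a → f (a⁻¹ * g0) = f g0 := by
    intro a ha
    have hs : ∑ k, f k * (f g0 - f (k⁻¹ * g0)) = 0 := by
      simp only [mul_sub]
      rw [Finset.sum_sub_distrib, ← Finset.sum_mul, h1, one_mul, sub_eq_zero]
      exact (congrFun h g0).symm
    have := (Finset.sum_eq_zero_iff_of_nonneg (fun k _ => mul_nonneg (h0 _)
      (sub_nonneg.2 (hg0 _)))).1 hs a (Finset.mem_univ a)
    rcases mul_eq_zero.1 this with h' | h'
    · exact absurd h' ha.ne'
    · linarith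
  have hone : 0 < f 1 := by
    have := hmax g0 hpos
    rw [inv_mul_cancel] at this
    rw [this]; exact hpos
  have hpow : ∀ a, 0 < f a → ∀ n : ℕ, 0 < f (a ^ n) := by
    intro a ha n
    induction n with
    | zero => simpa using hone
    | succ n ih => rw [pow_succ]; exact hmul _ _ ih ha
  have hinv : ∀ a, 0 < f a → 0 < f a⁻¹ := by
    intro a ha
    have : a⁻¹ = a ^ (orderOf a - 1) := by
      rw [inv_eq_iff_mul_eq_one, ← pow_succ', Nat.sub_add_cancel (orderOf_pos a), pow_orderOf_eq_one]
    rw [this]; exact hpow a ha _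
  let H : Subgroup G :=
    { carrier := {g | 0 < f g}
      mul_mem' := fun ha hb => hmul _ _ ha hb
      one_mem' := hone
      inv_mem' := fun ha => hinv _ ha }
  have hconst : ∀ g, f g = if g ∈ H then f g0 else 0 := by
    intro g
    split_ifs with hg
    · have := hmax (g0 * g⁻¹) (hmul _ _ hpos (hinv _ hg))
      simpa using this
    · exact le_antisymm (not_lt.1 hg) (h0 g)
  have hcard : (Nat.card H : ℝ) * f g0 = 1 := by
    rw [← h1]
    conv_rhs => rw [Finset.sum_congr rfl fun g _ => hconst g]
    rw [Finset.sum_ite, Finset.sum_const_zero, add_zero, Finset.sum_const, nsmul_eq_mul,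
      ← Fintype.card_subtype, Nat.card_eq_fintype_card]
  refine ⟨H, funext fun g => ?_⟩
  rw [hconst g, uniformOn]
  congr 1
  have : (Nat.card H : ℝ) ≠ 0 := by
    intro h; rw [h] at hcard; simp at hcard
  field_simp; linarith

lemma coset_pow {H : Subgroup G} {x y : Matrix G G ℝ} (hx : x ∈ PM G) (hy : y ∈ PM G)
    (h1 : x * Lm (uniformOn H) = x) (h2 : Lm (uniformOn H) * x = x)
    (hxy : x * y = Lm (uniformOn H)) : x ^ Fintype.card G = Lm (uniformOn H) := by
  obtain ⟨f, ⟨hf0, hf1⟩, rfl⟩ := hx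
  obtain ⟨f', ⟨hf0', hf1'⟩, rfl⟩ := hy
  rw [← Lm_conv] at h1 h2 hxy
  replace h1 := Lm_injective h1
  replace h2 := Lm_injective h2
  replace hxy := Lm_injective hxy
  obtain ⟨b, hb⟩ : ∃ b, 0 < f' b := by
    by_contra hn
    push Not at hn
    have : ∀ b, f' b = 0 := fun b => le_antisymm (hn b) (hf0' b)
    simp [this] at hf1'
  have hsupp : ∀ a, f a ≠ 0 → a * b ∈ H := by
    intro a ha
    by_contra hn
    have hz : conv f f' (a * b) = 0 := by rw [hxy]; simp [uniformOn, hn]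
    have := (Finset.sum_eq_zero_iff_of_nonneg (fun k _ => mul_nonneg (hf0 _) (hf0' _))).1 hz a
      (Finset.mem_univ a)
    simp only [inv_mul_cancel_left] at this
    rcases mul_eq_zero.1 this with h | h
    · exact ha h
    · exact hb.ne' h
  have hform : f = fun a => uniformOn H (a * b) := by
    ext a
    conv_lhs => rw [← h2]
    have : ∀ k, uniformOn H k * f (k⁻¹ * a) = uniformOn H (a * b) * f (k⁻¹ * a) := by
      intro k
      by_cases hk : f (k⁻¹ * a) = 0
      · rw [hk]; simp
      · have h3 := hsupp _ hk
        have h4 : k ∈ H ↔ a * b ∈ H := by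
          have : a * b = k * (k⁻¹ * a * b) := by group
          rw [this, H.mul_mem_cancel_right h3]
        simp only [uniformOn, h4]
    rw [conv, Finset.sum_congr rfl fun k _ => this k, ← Finset.mul_sum]
    have h5 : ∑ k, f (k⁻¹ * a) = ∑ k, f k :=
      Fintype.sum_equiv ((Equiv.inv G).trans (Equiv.mulRight a)) _ _ (fun k => by simp)
    rw [h5, hf1, mul_one]
  have hpow : ∀ m : ℕ, Lm f ^ m * Lm (uniformOn H) = Lm fun a => uniformOn H (a * b ^ m) := by
    intro m
    induction m with
    | zero => simp
    | succ m ih =>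
      rw [pow_succ', mul_assoc, ih, ← Lm_conv]
      congr 1
      ext a
      have : conv f (fun a => uniformOn H (a * b ^ m)) a = conv f (uniformOn H) (a * b ^ m) := by
        simp only [conv, mul_assoc]
      rw [this, h1]
      conv_lhs => rw [hform]
      simp only [pow_succ, mul_assoc]
  have h6 := hpow (Fintype.card G)
  have h7 : Lm f ^ Fintype.card G * Lm (uniformOn H) = Lm f ^ Fintype.card G := by
    obtain ⟨j, hj⟩ : ∃ j, Fintype.card G = j + 1 := ⟨_, (Nat.succ_pred_eq_of_pos Fintype.card_pos).symm⟩
    rw [hj, pow_succ, mul_assoc, ← Lm_conv, h1]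
  rw [h7] at h6
  rw [h6]
  simp

lemma main1 (μ : G → ℝ)
    (hdiv : ∀ n : ℕ, 0 < n →
      ∃ ν : G → ℝ, (∀ g, 0 ≤ ν g) ∧ (∑ g, ν g = 1) ∧ convNPow ν n = μ) :
    ∃ H : Subgroup G, ∃ z : ℕ → Matrix G G ℝ, ∃ m : ℕ → ℕ,
      Lm (uniformOn H) ∈ PM G ∧
      Lm (uniformOn H) * Lm (uniformOn H) = Lm (uniformOn H) ∧
      (1 - Lm (uniformOn H) + Lm μ).det ≠ 0 ∧ Tendsto m atTop atTop ∧
      Tendsto z atTop (𝓝 (Lm (uniformOn H))) ∧ ∀ n, 0 < m n ∧ z n ∈ PM G ∧ z n ^ m n = Lm μ ∧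
        z n * Lm (uniformOn H) = z n ∧ Lm (uniformOn H) * z n = z n := by
  obtain ⟨e, hee, hdet, hroots⟩ := roots μ hdiv
  have hN : 0 < Fintype.card G := Fintype.card_pos
  have hr : ∀ n : ℕ, ∃ x ∈ PM G, x ^ (Fintype.card G * (n + 1)) = Lm μ ∧ x * e = x ∧ e * x = x :=
    fun n => hroots _ (Nat.mul_pos hN (Nat.succ_pos n))
  choose w hwP hwpow hwe hew using hr
  obtain ⟨x, hx, ψ, hψ, hlim⟩ := PM_compact.tendsto_subseq hwP
  have hxe : x * e = x := tendsto_nhds_unique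
    ((hlim.mul_const e).congr fun j => hwe _) hlim
  have hex : e * x = x := tendsto_nhds_unique
    ((hlim.const_mul e).congr fun j => hew _) hlim
  have hd : |(1 - e + x).det| = 1 := by
    have hc : Continuous fun m : Matrix G G ℝ => |(1 - e + m).det| := by
      refine continuous_abs.comp (Continuous.matrix_det ?_)
      fun_prop
    refine tendsto_nhds_unique ((hc.tendsto x).comp hlim) ?_
    have hD : 0 < |(1 - e + Lm μ).det| := abs_pos.2 hdet
    have heq : ∀ n, |(1 - e + w n).det| =
        |(1 - e + Lm μ).det| ^ (((Fintype.card G * (n + 1) : ℕ) : ℝ)⁻¹) := by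
      intro n
      have hpos : 0 < Fintype.card G * (n + 1) := Nat.mul_pos hN (Nat.succ_pos n)
      rw [← hwpow n, ← one_sub_add_pow hee (hwe n) (hew n) hpos, Matrix.det_pow, abs_pow,
        Real.pow_rpow_inv_natCast (abs_nonneg _) hpos.ne']
    have h0 : Tendsto (fun n : ℕ => (((Fintype.card G * (n + 1) : ℕ) : ℝ)⁻¹)) atTop (𝓝 0) := by
      refine tendsto_inv_atTop_zero.comp (tendsto_natCast_atTop_atTop.comp ?_)
      refine tendsto_atTop_mono (fun n => ?_) tendsto_id
      simp only [id]
      nlinarith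
    have h1 : Tendsto (fun n => |(1 - e + w n).det|) atTop (𝓝 1) := by
      simp only [heq]
      have := (Real.continuousAt_const_rpow hD.ne' (b := 0)).tendsto.comp h0
      simpa [Function.comp_def] using this
    exact h1.comp hψ.tendsto_atTop
  obtain ⟨y, hy, hxy⟩ := limit_inv hee hx hxe hex hd
  have heP : e ∈ PM G := hxy ▸ PM_mul hx hy
  obtain ⟨f, hf, rfl⟩ := heP
  obtain ⟨H, rfl⟩ := idem_uniform hf (Lm_injective (by rw [Lm_conv, hee]))
  have hxN := coset_pow hx hy hxe hex hxy
  refine ⟨H, fun n => w (ψ n) ^ Fintype.card G, fun n => ψ n + 1, ⟨_, hf, rfl⟩, hee, hdet,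
    (tendsto_add_atTop_nat 1).comp hψ.tendsto_atTop, ?_, fun n => ⟨Nat.succ_pos _, PM_pow (hwP _) _,
      ?_, ?_, ?_⟩⟩
  · rw [← hxN]; exact hlim.pow _
  · rw [← pow_mul, hwpow]
  · obtain ⟨j, hj⟩ : ∃ j, Fintype.card G = j + 1 := ⟨_, (Nat.succ_pred_eq_of_pos hN).symm⟩
    simp only [hj]
    rw [pow_succ, mul_assoc, hwe]
  · obtain ⟨j, hj⟩ : ∃ j, Fintype.card G = j + 1 := ⟨_, (Nat.succ_pred_eq_of_pos hN).symm⟩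
    simp only [hj]
    rw [pow_succ', ← mul_assoc, hew]

lemma det_bound {n : Type*} [Fintype n] (T : Matrix n n ℝ) :
    T.det ^ 2 ≤ Real.exp ((T * T.transpose).trace - Fintype.card n) := by
  have hp : (T * T.transpose).PosSemidef := by
    have := Matrix.posSemidef_self_mul_conjTranspose T
    rwa [Matrix.conjTranspose_eq_transpose_of_trivial] at this
  have h1 : T.det ^ 2 = (T * T.transpose).det := by
    rw [Matrix.det_mul, Matrix.det_transpose, sq]
  have h2 := hp.isHermitian.det_eq_prod_eigenvalues
  have h3 := hp.isHermitian.trace_eq_sum_eigenvalues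
  simp only [RCLike.ofReal_real_eq_id, id] at h2 h3
  rw [h1, h2, h3]
  have : (∑ i, hp.isHermitian.eigenvalues i) - (Fintype.card n : ℝ) =
      ∑ i, (hp.isHermitian.eigenvalues i - 1) := by
    rw [Finset.sum_sub_distrib]; simp
  rw [this, Real.exp_sum]
  refine Finset.prod_le_prod (fun i _ => hp.eigenvalues_nonneg i) fun i _ => ?_
  have := Real.add_one_le_exp (hp.isHermitian.eigenvalues i - 1)
  linarith

lemma left_inv {H : Subgroup G} {f : G → ℝ} (hf : conv (uniformOn H) f = f) {h : G} (hh : h ∈ H)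
    (a : G) : f (h * a) = f a := by
  rw [← hf]
  simp only [conv]
  refine (Fintype.sum_equiv (Equiv.mulLeft h) _ _ fun k => ?_).symm
  simp only [uniformOn, Equiv.coe_mulLeft, mul_inv_rev, H.mul_mem_cancel_left hh]
  congr 2
  group

lemma defect {H : Subgroup G} {f : G → ℝ} (hf : f ∈ stdSimplex ℝ G)
    (he : conv (uniformOn H) f = f) :
    0 ≤ 1 - Nat.card H * f 1 ∧
    (∀ a ∈ H, f a - uniformOn H a = -((1 - Nat.card H * f 1) / Nat.card H)) ∧
    (∀ a ∉ H, 0 ≤ f a - uniformOn H a ∧ f a - uniformOn H a ≤ 1 - Nat.card H * f 1) := by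
  obtain ⟨h0, h1⟩ := hf
  have hc : (Nat.card H : ℝ) ≠ 0 := by
    exact_mod_cast Nat.card_pos.ne'
  have hH : ∀ a ∈ H, f a = f 1 := fun a ha => by simpa using left_inv he ha 1
  have hsum : Nat.card H * f 1 + ∑ a with a ∉ H, f a = 1 := by
    rw [← h1, ← Finset.sum_filter_add_sum_filter_not Finset.univ (fun a => a ∈ H) f]
    congr 1
    rw [Finset.sum_congr rfl (g := fun _ => f 1) (fun a ha => hH a (by simpa using ha)),
      Finset.sum_const, nsmul_eq_mul, ← Fintype.card_subtype, Nat.card_eq_fintype_card]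
  have hs : ∑ a with a ∉ H, f a = 1 - Nat.card H * f 1 := by linarith
  refine ⟨hs ▸ Finset.sum_nonneg fun a _ => h0 a, fun a ha => ?_, fun a ha => ?_⟩
  · rw [hH a ha]; simp only [uniformOn, ha, if_true]; field_simp; ring
  · simp only [uniformOn, ha, if_false, sub_zero]
    refine ⟨h0 a, ?_⟩
    rw [← hs]
    exact Finset.single_le_sum (f := f) (fun a _ => h0 a) (by simpa using ha)

lemma rate {H : Subgroup G} {f : G → ℝ} (hf : f ∈ stdSimplex ℝ G)
    (he : conv (uniformOn H) f = f)
    (hsmall : (Fintype.card G : ℝ) ^ 2 * (1 - Nat.card H * f 1) ≤ 1) :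
    (1 - Lm (uniformOn H) + Lm f).det ^ 2 ≤ Real.exp (-(1 - Nat.card H * f 1)) := by
  obtain ⟨hε, hin, hout⟩ := defect hf he
  set ε := 1 - Nat.card H * f 1
  have hc1 : (1 : ℝ) ≤ Nat.card H := by exact_mod_cast Nat.card_pos
  have hcN : (Nat.card H : ℝ) ≤ Fintype.card G := by
    rw [← Nat.card_eq_fintype_card]
    exact_mod_cast Subgroup.card_le_card_group H
  have hq : ∀ a, (f a - uniformOn H a) ^ 2 ≤ ε ^ 2 := by
    intro a
    apply sq_le_sq'
    · by_cases ha : a ∈ H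
      · rw [hin a ha, neg_le_neg_iff]; exact div_le_self hε hc1
      · linarith [(hout a ha).1]
    · by_cases ha : a ∈ H
      · rw [hin a ha]
        have : 0 ≤ ε / Nat.card H := by positivity
        linarith
      · exact (hout a ha).2
  refine (det_bound _).trans (Real.exp_le_exp.2 ?_)
  set Q : Matrix G G ℝ := Lm fun a => f a - uniformOn H a with hQ
  have hT : 1 - Lm (uniformOn H) + Lm f = 1 + Q := by
    ext g h
    simp [hQ, Lm]; ring
  have htr : Q.trace = -(Fintype.card G * (ε / Nat.card H)) := by
    simp only [Matrix.trace, Matrix.diag, hQ, Lm, mul_inv_cancel]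
    rw [hin 1 H.one_mem]; simp
  have htr2 : (Q * Q.transpose).trace ≤ Fintype.card G ^ 2 * ε ^ 2 := by
    simp only [Matrix.trace, Matrix.diag, Matrix.mul_apply, Matrix.transpose_apply]
    calc ∑ g, ∑ h, Q g h * Q g h ≤ ∑ g : G, ∑ h : G, ε ^ 2 := by
          refine Finset.sum_le_sum fun g _ => Finset.sum_le_sum fun h _ => ?_
          rw [← sq]; exact hq _
      _ = _ := by simp; ring
  rw [hT, Matrix.transpose_add, Matrix.transpose_one, add_mul, one_mul, mul_add, mul_one,
    Matrix.trace_add, Matrix.trace_add, Matrix.trace_add, Matrix.trace_one, Matrix.trace_transpose,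
    htr]
  have h3 : ε ≤ Fintype.card G * (ε / Nat.card H) := by
    rw [mul_div_assoc', le_div_iff₀ (by linarith)]
    nlinarith
  nlinarith

lemma PM_entry {x : Matrix G G ℝ} (hx : x ∈ PM G) (g h : G) : |x g h| ≤ 1 := by
  obtain ⟨f, ⟨h0, h1⟩, rfl⟩ := hx
  rw [Lm, abs_of_nonneg (h0 _), ← h1]
  exact Finset.single_le_sum (fun a _ => h0 a) (Finset.mem_univ _)

lemma rate_bound {μ : G → ℝ} {H : Subgroup G} {z : ℕ → Matrix G G ℝ} {m : ℕ → ℕ}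
    (hdet : (1 - Lm (uniformOn H) + Lm μ).det ≠ 0)
    (hz : Tendsto z atTop (𝓝 (Lm (uniformOn H))))
    (hzn : ∀ n, 0 < m n ∧ z n ∈ PM G ∧ z n ^ m n = Lm μ ∧
        z n * Lm (uniformOn H) = z n ∧ Lm (uniformOn H) * z n = z n) :
    ∃ C : ℝ, ∀ᶠ n in atTop, m n * (1 - Nat.card H * z n 1 1) ≤ C := by
  by_cases hee : Lm (uniformOn H) * Lm (uniformOn H) = Lm (uniformOn H)
  swap
  · exfalso
    apply hee
    exact tendsto_nhds_unique ((hz.const_mul _).congr fun n => (hzn n).2.2.2.2) hz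
  refine ⟨-Real.log ((1 - Lm (uniformOn H) + Lm μ).det ^ 2), ?_⟩
  have hc : (Nat.card H : ℝ) ≠ 0 := by
    exact_mod_cast Nat.card_pos.ne'
  have hcont : Continuous fun x : Matrix G G ℝ =>
      (Fintype.card G : ℝ) ^ 2 * (1 - Nat.card H * x 1 1) := by
    have := (continuous_id (X := Matrix G G ℝ)).matrix_elem 1 1
    simp only [id] at this
    fun_prop
  have h0 := (hcont.tendsto _).comp hz
  have hval : (Fintype.card G : ℝ) ^ 2 * (1 - Nat.card H * Lm (uniformOn H) 1 1) = 0 := by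
    have : Lm (uniformOn H) 1 1 = 1 / (Nat.card H : ℝ) := by
      simp [Lm, uniformOn, H.one_mem]
    rw [this]; field_simp; ring
  rw [hval] at h0
  filter_upwards [h0.eventually (ge_mem_nhds one_pos)] with n hn
  obtain ⟨hm0, hzP, hpow, hze, hez⟩ := hzn n
  rw [← hpow, ← one_sub_add_pow hee hze hez hm0, Matrix.det_pow] at hdet ⊢
  have hd : (1 - Lm (uniformOn H) + z n).det ≠ 0 := fun h => hdet (by rw [h, zero_pow hm0.ne'])
  simp only [Function.comp] at hn
  obtain ⟨f, hf, hfz⟩ := hzP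
  rw [← hfz] at hn hez hd ⊢
  have h1 : Lm f 1 1 = f 1 := by simp [Lm]
  rw [h1] at hn ⊢
  have hr := rate hf (Lm_injective (by rw [Lm_conv, hez])) hn
  have hl := Real.log_le_log (by positivity) hr
  rw [Real.log_exp] at hl
  rw [← pow_mul, mul_comm (m n) 2, pow_mul, Real.log_pow]
  nlinarith [(Nat.cast_nonneg (m n) : (0:ℝ) ≤ m n)]

lemma PM_V {H : Subgroup G} {z : Matrix G G ℝ} {m : ℕ} {r : ℝ} (heP : Lm (uniformOn H) ∈ PM G)
    (hz : z ∈ PM G) (hez : Lm (uniformOn H) * z = z) (hr : 0 < r)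
    (hm : m * (1 - Nat.card H * z 1 1) ≤ r) :
    Lm (uniformOn H) + ((m : ℝ) / r) • (z - Lm (uniformOn H)) ∈ PM G := by
  obtain ⟨u, ⟨hu0, hu1⟩, hu⟩ := heP
  obtain rfl := Lm_injective hu
  obtain ⟨f, hf, rfl⟩ := hz
  have h1 : Lm f 1 1 = f 1 := by simp [Lm]
  rw [h1] at hm
  obtain ⟨hε, hin, hout⟩ := defect hf (Lm_injective (by rw [Lm_conv, hez]))
  refine ⟨fun a => uniformOn H a + ((m : ℝ) / r) * (f a - uniformOn H a), ⟨fun a => ?_, ?_⟩, ?_⟩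
  · by_cases ha : a ∈ H
    · change 0 ≤ uniformOn H a + ((m : ℝ) / r) * (f a - uniformOn H a)
      rw [hin a ha]
      have hc : (0 : ℝ) < Nat.card H := by exact_mod_cast Nat.card_pos
      simp only [uniformOn, ha, if_true]
      have : 1 / (Nat.card H : ℝ) + m / r * -((1 - Nat.card H * f 1) / Nat.card H) =
        (r - m * (1 - Nat.card H * f 1)) / (r * Nat.card H) := by field_simp; ring
      rw [this]
      exact div_nonneg (by linarith) (by positivity)
    · exact add_nonneg (hu0 a) (mul_nonneg (by positivity) (hout a ha).1)
  · rw [Finset.sum_add_distrib, ← Finset.mul_sum, Finset.sum_sub_distrib, hu1, hf.2]; simp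
  · ext g h
    simp [Lm]

lemma binom_entry {e V z : Matrix G G ℝ} {p : ℝ} {m : ℕ} (hee : e * e = e) (heV : e * V = V)
    (hVe : V * e = V) (hz : z = (1 - p) • e + p • V) (hm : 0 < m) (g h : G) :
    (z ^ m) g h = ∑' k : ℕ, (m.choose k : ℝ) * p ^ k * (1 - p) ^ (m - k) * (e * V ^ k) g h := by
  have h1 : z = e * (p • V + (1 - p) • (1 : Matrix G G ℝ)) := by
    rw [hz, mul_add, mul_smul_comm, mul_smul_comm, mul_one, heV, add_comm]
  have hc : Commute e (p • V + (1 - p) • (1 : Matrix G G ℝ)) := by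
    refine Commute.add_right (Commute.smul_right ?_ _) ((Commute.one_right _).smul_right _)
    rw [commute_iff_eq, heV, hVe]
  have hid : IsIdempotentElem e := hee
  have hc2 : Commute (p • V) ((1 - p) • (1 : Matrix G G ℝ)) := (Commute.one_right _).smul_right _
  rw [h1, hc.mul_pow, hid.pow_eq hm.ne', hc2.add_pow, Finset.mul_sum, Matrix.sum_apply,
    tsum_eq_sum (s := Finset.range (m + 1))]
  · refine Finset.sum_congr rfl fun k _ => ?_
    have : e * ((p • V) ^ k * ((1 - p) • (1 : Matrix G G ℝ)) ^ (m - k) * ((m.choose k : ℕ) :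
        Matrix G G ℝ)) = ((m.choose k : ℝ) * p ^ k * (1 - p) ^ (m - k)) • (e * V ^ k) := by
      rw [smul_pow, smul_pow, one_pow, ← nsmul_eq_mul', ← Nat.cast_smul_eq_nsmul ℝ]
      simp only [mul_smul_comm, smul_mul_assoc, mul_one, smul_smul]
      congr 1; ring
    rw [this, Matrix.smul_apply, smul_eq_mul]
  · intro k hk
    have : m < k := by simpa using hk
    rw [Nat.choose_eq_zero_of_lt this]; simp

end Helpers

/-- Every infinitely divisible probability distribution on a finite group is of Poisson type. -/
theorem infinitely_divisible_prob_is_poisson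
    {G : Type*} [Group G] [Fintype G] (μ : G → ℝ)
    (hμ0 : ∀ g, 0 ≤ μ g) (hμ1 : ∑ g, μ g = 1)
    (hdiv : ∀ n : ℕ, 0 < n →
      ∃ ν : G → ℝ, (∀ g, 0 ≤ ν g) ∧ (∑ g, ν g = 1) ∧ convNPow ν n = μ) :
    ∃ (H : Subgroup G) (r : ℝ) (ν : G → ℝ),
      0 ≤ r ∧ (∀ g, 0 ≤ ν g) ∧ (∑ g, ν g = 1) ∧
      conv (uniformOn H) ν = ν ∧ conv ν (uniformOn H) = ν ∧
      ∀ g, μ g = Real.exp (-r) *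
        ∑' k : ℕ, r ^ k / (Nat.factorial k : ℝ) * convPowFrom (uniformOn H) ν k g := by
  obtain ⟨H, z, m, heP, hee, hdet, hm, hz, hzn⟩ := main1 μ hdiv
  obtain ⟨C, hC⟩ := rate_bound hdet hz hzn
  obtain ⟨r, hr, hrC⟩ : ∃ r : ℝ, 0 < r ∧ C ≤ r :=
    ⟨max C 1, lt_of_lt_of_le one_pos (le_max_right _ _), le_max_left _ _⟩
  set e := Lm (uniformOn H) with he
  let V : ℕ → Matrix G G ℝ := fun n => e + ((m n : ℝ) / r) • (z n - e)
  have hVP : ∀ᶠ n in atTop, V n ∈ PM G := by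
    filter_upwards [hC] with n hn
    exact PM_V heP (hzn n).2.1 (hzn n).2.2.2.2 hr (hn.trans hrC)
  obtain ⟨W, hW, θ, hθ, hlim⟩ := PM_compact.tendsto_subseq' hVP.frequently
  have hVe : ∀ n, V n * e = V n := fun n => by
    simp only [V, add_mul, smul_mul_assoc, sub_mul, hee, (hzn n).2.2.2.1]
  have heV : ∀ n, e * V n = V n := fun n => by
    simp only [V, mul_add, mul_smul_comm, mul_sub, hee, (hzn n).2.2.2.2]
  have hWe : W * e = W := tendsto_nhds_unique
    ((hlim.mul_const e).congr fun j => hVe _) hlim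
  have heW : e * W = W := tendsto_nhds_unique
    ((hlim.const_mul e).congr fun j => heV _) hlim
  obtain ⟨ν, ⟨hν0, hν1⟩, rfl⟩ := hW
  refine ⟨H, r, ν, hr.le, hν0, hν1, Lm_injective (by rw [Lm_conv]; exact heW),
    Lm_injective (by rw [Lm_conv]; exact hWe), fun g => ?_⟩
  have hexp : ∀ n, μ g = ∑' k : ℕ, ((m n).choose k : ℝ) * (r / m n) ^ k *
      (1 - r / m n) ^ (m n - k) * (e * V n ^ k) g 1 := by
    intro n
    obtain ⟨hm0, hzP, hpow, hze, hez⟩ := hzn n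
    have h1 : μ g = (z n ^ m n) g 1 := by rw [hpow]; simp [Lm]
    rw [h1]
    exact binom_entry hee (heV n) (hVe n) (by
      have : (m n : ℝ) ≠ 0 := by exact_mod_cast hm0.ne'
      simp only [V, smul_add, smul_smul]
      rw [div_mul_div_comm, mul_comm, div_self (by positivity), sub_smul]
      simp only [one_smul]
      abel) hm0 g 1
  have hmθ : Tendsto (fun n => m (θ n)) atTop atTop := hm.comp hθ.tendsto_atTop
  have hT : Tendsto (fun n => ∑' k : ℕ, ((m (θ n)).choose k : ℝ) * (r / m (θ n)) ^ k *
      (1 - r / m (θ n)) ^ (m (θ n) - k) * (e * V (θ n) ^ k) g 1) atTop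
      (𝓝 (∑' k : ℕ, Real.exp (-r) * r ^ k / (Nat.factorial k : ℝ) * (e * Lm ν ^ k) g 1)) := by
    refine tendsto_tsum_of_dominated_convergence (bound := fun k => r ^ k / (Nat.factorial k : ℝ))
      (Real.summable_pow_div_factorial r) ?_ ?_
    · intro k
      have hp : Tendsto (fun n : ℕ => (n : ℝ) * (r / n)) atTop (𝓝 r) := by
        refine tendsto_const_nhds.congr' ?_
        filter_upwards [eventually_gt_atTop 0] with n hn
        have : (n : ℝ) ≠ 0 := by exact_mod_cast hn.ne'
        field_simp
      have h1 := (ProbabilityTheory.tendsto_choose_mul_pow_of_tendsto_mul_atTop k hp).comp hmθ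
      have h2 : Tendsto (fun n => e * V (θ n) ^ k) atTop (𝓝 (e * Lm ν ^ k)) :=
        (hlim.pow k).const_mul e
      have h3 : Tendsto (fun n => (e * V (θ n) ^ k) g 1) atTop (𝓝 ((e * Lm ν ^ k) g 1)) :=
        ((continuous_id.matrix_elem g 1).tendsto _).comp h2
      exact h1.mul h3
    · have hlarge : ∀ᶠ n in atTop, r ≤ (m (θ n) : ℝ) :=
        (tendsto_natCast_atTop_atTop.comp hmθ).eventually_ge_atTop r
      filter_upwards [hlarge, hθ.tendsto_atTop.eventually hVP] with n hn hVn k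
      have hmpos : 0 < (m (θ n) : ℝ) := lt_of_lt_of_le hr hn
      have hp1 : r / m (θ n) ≤ 1 := (div_le_one hmpos).2 hn
      have hp0 : 0 ≤ r / m (θ n) := by positivity
      have hE := PM_entry (PM_mul heP (PM_pow hVn k)) g 1
      have hq : (1 - r / m (θ n)) ^ (m (θ n) - k) ≤ 1 :=
        pow_le_one₀ (by linarith) (by linarith)
      have hq0 : 0 ≤ (1 - r / m (θ n)) ^ (m (θ n) - k) := pow_nonneg (by linarith) _
      have hch : ((m (θ n)).choose k : ℝ) * (r / m (θ n)) ^ k ≤ r ^ k / (Nat.factorial k : ℝ) := by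
        have := mul_le_mul_of_nonneg_right (Nat.choose_le_pow_div (α := ℝ) k (m (θ n)))
          (pow_nonneg hp0 k)
        refine this.trans (le_of_eq ?_)
        rw [div_pow]; field_simp
      have hch0 : 0 ≤ ((m (θ n)).choose k : ℝ) * (r / m (θ n)) ^ k := by positivity
      rw [Real.norm_eq_abs, abs_mul, abs_mul, abs_of_nonneg hch0, abs_of_nonneg hq0]
      calc _ ≤ ((m (θ n)).choose k : ℝ) * (r / m (θ n)) ^ k * 1 * 1 := by gcongr
        _ ≤ _ := by rw [mul_one, mul_one]; exact hch
  have hfin := tendsto_nhds_unique (tendsto_const_nhds.congr fun n => hexp (θ n)) hT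
  rw [hfin, ← tsum_mul_left]
  refine tsum_congr fun k => ?_
  have : convPowFrom (uniformOn H) ν k g = (e * Lm ν ^ k) g 1 := by
    rw [he, ← Lm_convPowFrom]; simp [Lm]
  rw [this]; ring
end

section
/- Let G be a finite group with identity element e. Let φ : G → ℂ be a normalized positive definite function that is infinitely divisible under pointwise multiplication: for every positive integer n there exists a normalized positive definite function φ_n on G with φ_n(g)^n = φ(g) for all g ∈ G. Then φ is of Poisson type: there exist a subgroup H of G, a real number r ≥ 0, and a normalized positive definite function v on G vanishing outside H, such that φ(g) = exp(r(v(g) − 1)) for all g ∈ H and φ(g) = 0 for all g ∉ H. -/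
open scoped ComplexOrder

/-- A function `φ : G → ℂ` on a group is positive definite if for every tuple
`g_1, …, g_n` the matrix `(φ(g_i⁻¹ g_j))_{i,j}` is positive semi-definite. -/
def IsPosDefFn {G : Type*} [Group G] (φ : G → ℂ) : Prop :=
  ∀ (n : ℕ) (g : Fin n → G), (Matrix.of fun i j : Fin n => φ ((g i)⁻¹ * g j)).PosSemidef

open Filter Topology

section helpers

variable {G : Type*} [Group G]

theorem IsPosDefFn.conj_inv {φ : G → ℂ} (h : IsPosDefFn φ) (g : G) :
    φ g⁻¹ = star (φ g) := by
  have h1 := (h 2 ![1, g]).isHermitian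
  have h2 := h1.apply 1 0
  simpa using h2.symm

theorem IsPosDefFn.one_nonneg {φ : G → ℂ} (h : IsPosDefFn φ) : 0 ≤ φ 1 := by
  have h1 := (h 1 ![1]).diag_nonneg (i := 0)
  simpa using h1

theorem IsPosDefFn.one_eq {φ : G → ℂ} (h : IsPosDefFn φ) : φ 1 = ((φ 1).re : ℂ) := by
  have := Complex.le_def.1 h.one_nonneg
  apply Complex.ext
  · simp
  · simpa using this.2.symm

theorem IsPosDefFn.norm_le {φ : G → ℂ} (h : IsPosDefFn φ) (g : G) :
    ‖φ g‖ ≤ (φ 1).re := by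
  have h1 := (h 2 ![1, g]).det_nonneg
  have h0 := (Complex.le_def.1 h.one_nonneg).1
  rw [Matrix.det_fin_two] at h1
  simp [h.conj_inv] at h1
  rw [Complex.mul_conj, h.one_eq, Complex.normSq_eq_norm_sq] at h1
  have h2 : ‖φ g‖ ^ 2 ≤ (φ 1).re * (φ 1).re := by exact_mod_cast h1
  simp at h0
  nlinarith [norm_nonneg (φ g)]

theorem IsPosDefFn.mul_eq {φ : G → ℂ} (h : IsPosDefFn φ) (h1 : φ 1 = 1) (a b : G)
    (ha : ‖φ a‖ = 1) : φ (a * b) = φ a * φ b := by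
  have hd := (h 3 ![a⁻¹, 1, b]).det_nonneg
  rw [Matrix.det_fin_three] at hd
  have e2 : φ (b⁻¹ * a⁻¹) = star (φ (a * b)) := by rw [← h.conj_inv]; simp
  simp [h.conj_inv, h1, e2] at hd
  have hk : (starRingEnd ℂ) (φ a) * φ a = 1 := by
    rw [mul_comm, Complex.mul_conj, Complex.normSq_eq_norm_sq, ha]; simp
  set A := φ a
  set B := φ b
  set C := φ (a * b)
  have key : (0 : ℂ) ≤ -((Complex.normSq (C - A * B) : ℝ) : ℂ) := by
    rw [← Complex.mul_conj]
    refine (sub_nonneg.2 hd).trans (le_of_eq ?_)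
    simp only [map_sub, map_mul]
    linear_combination (B * (starRingEnd ℂ) B - 1) * hk
  have k2 : Complex.normSq (C - A * B) ≤ 0 := by
    have : (0:ℝ) ≤ -Complex.normSq (C - A * B) := by exact_mod_cast key
    linarith
  have k3 := Complex.normSq_eq_zero.1 (le_antisymm k2 (Complex.normSq_nonneg _))
  exact sub_eq_zero.1 k3

theorem isPosDefFn_one : IsPosDefFn (fun _ : G => (1 : ℂ)) := by
  intro n g
  have := Matrix.posSemidef_vecMulVec_self_star (fun _ : Fin n => (1 : ℂ))
  convert this using 1
  ext i j
  simp [Matrix.vecMulVec]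

theorem IsPosDefFn.pow {φ : G → ℂ} (h : IsPosDefFn φ) (k : ℕ) :
    IsPosDefFn (fun g => φ g ^ k) := by
  induction k with
  | zero => simpa using isPosDefFn_one
  | succ k ih =>
    intro n g
    have := (ih n g).hadamard (h n g)
    have e : (Matrix.of fun i j : Fin n => (fun g => φ g ^ (k + 1)) ((g i)⁻¹ * g j)) =
        (Matrix.of fun i j => (fun g => φ g ^ k) ((g i)⁻¹ * g j)).hadamard
          (Matrix.of fun i j => φ ((g i)⁻¹ * g j)) := by
      ext i j
      simp [pow_succ]
    rw [e]
    exact this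

theorem IsPosDefFn.add {φ ψ : G → ℂ} (h : IsPosDefFn φ) (h' : IsPosDefFn ψ) :
    IsPosDefFn (fun g => φ g + ψ g) := fun n g => (h n g).add (h' n g)

theorem IsPosDefFn.smul {φ : G → ℂ} (h : IsPosDefFn φ) (c : ℝ) (hc : 0 ≤ c) :
    IsPosDefFn (fun g => (c : ℂ) * φ g) := by
  intro n g
  have := (h n g).smul (a := (c : ℂ)) (by exact_mod_cast hc)
  convert this using 1
  ext i j
  simp

theorem IsPosDefFn.of_tendsto {l : Filter ℕ} [l.NeBot] {f : ℕ → G → ℂ} {φ : G → ℂ}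
    (hf : ∀ᶠ m in l, IsPosDefFn (f m)) (ht : ∀ g, Tendsto (fun m => f m g) l (𝓝 (φ g))) :
    IsPosDefFn φ := by
  intro n g
  apply Matrix.PosSemidef.of_dotProduct_mulVec_nonneg
  · ext i j
    have h1 : Tendsto (fun m => star (f m ((g j)⁻¹ * g i))) l (𝓝 (star (φ ((g j)⁻¹ * g i)))) :=
      (ht _).star
    have h2 := ht ((g i)⁻¹ * g j)
    refine tendsto_nhds_unique (h1.congr' ?_) h2
    filter_upwards [hf] with m hm
    exact (hm n g).isHermitian.apply i j
  · intro x
    have h1 : Tendsto (fun m => star x ⬝ᵥ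
        ((Matrix.of fun i j : Fin n => f m ((g i)⁻¹ * g j)).mulVec x)) l
        (𝓝 (star x ⬝ᵥ ((Matrix.of fun i j : Fin n => φ ((g i)⁻¹ * g j)).mulVec x))) := by
      simp only [dotProduct, Matrix.mulVec, Matrix.of_apply]
      exact tendsto_finsetSum _ fun i _ => Tendsto.const_mul _
        (tendsto_finsetSum _ fun j _ => (ht _).mul_const _)
    refine ge_of_tendsto h1 ?_
    filter_upwards [hf] with m hm
    exact (hm n g).dotProduct_mulVec_nonneg x

variable [Fintype G]

/-- The convolution matrix of a function. -/
def convMat (φ : G → ℂ) : Matrix G G ℂ := Matrix.of fun g h => φ (g⁻¹ * h)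

theorem isPosDefFn_iff (φ : G → ℂ) : IsPosDefFn φ ↔ (convMat φ).PosSemidef := by
  constructor
  · intro h
    have e := (Fintype.equivFin G).symm
    rw [← Matrix.posSemidef_submatrix_equiv e]
    exact h _ e
  · intro h n g
    exact h.submatrix g

open Classical in
/-- Indicator of a subgroup. -/
noncomputable def ind (H : Subgroup G) : G → ℂ := fun g => if g ∈ H then 1 else 0

theorem convMat_mul_ind (H : Subgroup G) (f : G → ℂ) (hf : ∀ g, g ∉ H → f g = 0) :
    convMat f * convMat (ind H) = (∑ u, f u) • convMat (ind H) := by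
  ext g h
  simp only [Matrix.mul_apply, convMat, Matrix.of_apply, Matrix.smul_apply, smul_eq_mul]
  rw [Finset.sum_mul, ← Equiv.sum_comp (Equiv.mulLeft g)]
  refine Finset.sum_congr rfl fun u _ => ?_
  by_cases hu : u ∈ H
  · have : ind H ((g * u)⁻¹ * h) = ind H (g⁻¹ * h) := by
      have : (g * u)⁻¹ * h ∈ H ↔ g⁻¹ * h ∈ H := by
        rw [mul_inv_rev, mul_assoc]
        exact H.mul_mem_cancel_left (H.inv_mem hu)
      unfold ind
      split_ifs <;> simp_all
    simp only [Equiv.coe_mulLeft, this, inv_mul_cancel_left]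
  · simp [hf u hu]

theorem convMat_ind_herm (H : Subgroup G) : (convMat (ind H)).conjTranspose = convMat (ind H) := by
  ext g h
  have : h⁻¹ * g ∈ H ↔ g⁻¹ * h ∈ H := by
    rw [← H.inv_mem_iff]; simp
  simp only [Matrix.conjTranspose_apply, convMat, Matrix.of_apply, ind]
  split_ifs <;> simp_all

open Classical in
theorem sum_ind (H : Subgroup G) : ∑ u, ind H u = ((Finset.univ.filter (· ∈ H)).card : ℂ) := by
  simp [ind]

open Classical in
theorem card_filter_pos (H : Subgroup G) : 0 < (Finset.univ.filter (· ∈ H)).card :=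
  Finset.card_pos.2 ⟨1, by simp [H.one_mem]⟩

theorem ind_posDef (H : Subgroup G) : IsPosDefFn (ind H) := by
  classical
  rw [isPosDefFn_iff]
  have h1 := convMat_mul_ind H (ind H) (fun g hg => by simp [ind, hg])
  rw [sum_ind] at h1
  have h2 := Matrix.posSemidef_conjTranspose_mul_self (convMat (ind H))
  rw [convMat_ind_herm, h1] at h2
  have hn := card_filter_pos H
  set n := (Finset.univ.filter (· ∈ H)).card
  have h3 := h2.smul (a := ((n : ℝ)⁻¹ : ℂ)) (by
    have : (0 : ℝ) ≤ (n : ℝ)⁻¹ := by positivity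
    exact_mod_cast this)
  rw [smul_smul] at h3
  have : ((n : ℝ)⁻¹ : ℂ) * (n : ℂ) = 1 := by
    have : (n : ℂ) ≠ 0 := by exact_mod_cast hn.ne'
    push_cast
    field_simp
  rwa [this, one_smul] at h3

open Classical in
/-- Splitting off the trivial representation of `H`. -/
theorem split_trivial (H : Subgroup G) (θ : G → ℂ) (h : IsPosDefFn θ) (h1 : θ 1 = 1)
    (h0 : ∀ g, g ∉ H → θ g = 0) :
    ∃ δ : ℝ, 0 ≤ δ ∧ IsPosDefFn (fun g => θ g - (1 - δ : ℝ) * ind H g) ∧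
      (∀ g ∈ H, ‖1 - θ g‖ ≤ 2 * δ) ∧
      ((Finset.univ.filter (· ∈ H)).card : ℝ) * δ
        = ∑ g ∈ Finset.univ.filter (· ∈ H), (1 - (θ g).re) := by
  have hn := card_filter_pos H
  have hcard := sum_ind H
  have hKK := convMat_mul_ind H (ind H) (fun g hg => by simp [ind, hg])
  have hTK := convMat_mul_ind H θ h0
  rw [hcard] at hKK
  have hsum : ∑ u, θ u = ∑ u ∈ Finset.univ.filter (· ∈ H), θ u := by
    rw [Finset.sum_filter]
    refine Finset.sum_congr rfl fun u _ => ?_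
    split_ifs with hu
    · rfl
    · exact h0 u hu
  set S := Finset.univ.filter (· ∈ H)
  set n := S.card
  have hn0 : (n : ℝ) ≠ 0 := by exact_mod_cast hn.ne'
  have hn0' : (n : ℂ) ≠ 0 := by exact_mod_cast hn.ne'
  have hreal : star (∑ u, θ u) = ∑ u, θ u := by
    rw [star_sum, ← Equiv.sum_comp (Equiv.inv G)]
    refine Finset.sum_congr rfl fun u _ => ?_
    simp [h.conj_inv]
  set s : ℝ := ∑ u ∈ S, (θ u).re
  have hs : ∑ u, θ u = (s : ℂ) := by
    have := Complex.conj_eq_iff_re.1 hreal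
    rw [← this, hsum, Complex.re_sum]
  have hKT : convMat (ind H) * convMat θ = (s : ℂ) • convMat (ind H) := by
    have := congrArg Matrix.conjTranspose hTK
    rw [Matrix.conjTranspose_mul, convMat_ind_herm, Matrix.conjTranspose_smul, hreal, hs,
      convMat_ind_herm, ((isPosDefFn_iff θ).1 h).isHermitian.eq] at this
    exact this
  rw [hs] at hTK
  have hpd : IsPosDefFn (fun g => θ g - (1 - (1 - s / n) : ℝ) * ind H g) := by
    rw [isPosDefFn_iff]
    set K := convMat (ind H) with hK
    set T := convMat θ with hT
    have hh := ((isPosDefFn_iff θ).1 h).conjTranspose_mul_mul_same (1 - (n : ℂ)⁻¹ • K)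
    have e1 : (1 - (n : ℂ)⁻¹ • K).conjTranspose = 1 - (n : ℂ)⁻¹ • K := by
      rw [Matrix.conjTranspose_sub, Matrix.conjTranspose_smul, hK, convMat_ind_herm]
      simp
    rw [e1, ← hT] at hh
    have e2 : (1 - (n : ℂ)⁻¹ • K) * T * (1 - (n : ℂ)⁻¹ • K) = T - ((s / n : ℝ) : ℂ) • K := by
      rw [sub_mul, mul_sub, sub_mul, one_mul, mul_one, mul_one, Matrix.smul_mul, hKT,
        Matrix.mul_smul, sub_mul, hTK, Matrix.smul_mul, Matrix.smul_mul, hKK]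
      simp only [smul_smul]
      have : (n:ℂ)⁻¹ * ((s:ℂ) * n) = s := by
        field_simp
      rw [this]
      have : (n:ℂ)⁻¹ * (s:ℂ) = ((s / n : ℝ) : ℂ) := by
        push_cast
        field_simp
      rw [this]
      simp
    rw [e2] at hh
    convert hh using 1
    ext a b
    simp [convMat, K, T]
  have hsδ : (n : ℝ) * (1 - s / n) = ∑ g ∈ S, (1 - (θ g).re) := by
    rw [Finset.sum_sub_distrib]
    simp only [Finset.sum_const, nsmul_eq_mul, mul_one]
    field_simp
    rfl
  have h11 : ind H 1 = 1 := by simp [ind, H.one_mem]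
  have hδ : 0 ≤ 1 - s / n := by
    have := (Complex.le_def.1 hpd.one_nonneg).1
    simp only [h1, h11] at this
    simpa using this
  refine ⟨1 - s / n, hδ, hpd, ?_, hsδ⟩
  intro g hg
  have hb := hpd.norm_le g
  have hg1 : ind H g = 1 := by simp [ind, hg]
  simp only [h1, h11, hg1] at hb
  have hb' : ‖θ g - ((1 - (1 - s / n) : ℝ) : ℂ)‖ ≤ 1 - s / n := by simpa using hb
  have : 1 - θ g = ((1 - s / n : ℝ) : ℂ) - (θ g - ((1 - (1 - s / n) : ℝ) : ℂ)) := by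
    push_cast; ring
  rw [this]
  refine (norm_sub_le _ _).trans ?_
  rw [Complex.norm_real, Real.norm_of_nonneg hδ]
  linarith

open Classical in
theorem delta_bound (H : Subgroup G) (θ : G → ℂ) (δ : ℝ) (hδ : δ ≤ 1 / 4) (hδ0 : 0 ≤ δ)
    (hb : ∀ g ∈ H, ‖1 - θ g‖ ≤ 2 * δ)
    (hs : ((Finset.univ.filter (· ∈ H)).card : ℝ) * δ
        = ∑ g ∈ Finset.univ.filter (· ∈ H), (1 - (θ g).re)) :
    δ ≤ ∑ g ∈ Finset.univ.filter (· ∈ H), (1 - ‖θ g‖ ^ 2) := by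
  have hn := card_filter_pos H
  have key : ∀ g ∈ Finset.univ.filter (· ∈ H),
      2 * (1 - (θ g).re) - 4 * δ ^ 2 ≤ 1 - ‖θ g‖ ^ 2 := by
    intro g hg
    have h1 := hb g (by simpa using hg)
    have h2 : ‖1 - θ g‖ ^ 2 ≤ 4 * δ ^ 2 := by nlinarith [norm_nonneg (1 - θ g)]
    rw [← Complex.normSq_eq_norm_sq, Complex.normSq_apply] at h2 ⊢
    simp at h2
    nlinarith
  have h3 := Finset.sum_le_sum key
  rw [Finset.sum_sub_distrib, ← Finset.mul_sum, ← hs] at h3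
  simp only [Finset.sum_const, nsmul_eq_mul] at h3
  refine le_trans ?_ h3
  have hn1 : (1 : ℝ) ≤ ((Finset.univ.filter (· ∈ H)).card : ℝ) := by exact_mod_cast hn
  nlinarith [mul_nonneg hδ0 (sub_nonneg.2 hδ), mul_nonneg (sub_nonneg.2 hn1) hδ0,
    mul_nonneg (by linarith : (0:ℝ) ≤ ((Finset.univ.filter (· ∈ H)).card : ℝ))
      (mul_nonneg hδ0 (sub_nonneg.2 hδ))]

end helpers

theorem ultra_lim (l : Ultrafilter ℕ) (f : ℕ → ℂ) (C : ℝ) (h : ∀ᶠ m in (l : Filter ℕ), ‖f m‖ ≤ C) :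
    ∃ z, Tendsto f l (𝓝 z) := by
  obtain ⟨z, -, hz⟩ := (isCompact_closedBall (0 : ℂ) C).ultrafilter_le_nhds (l.map f) (by
    rw [le_principal_iff]
    show ∀ᶠ m in (l : Filter ℕ), f m ∈ Metric.closedBall (0 : ℂ) C
    simpa using h)
  exact ⟨z, hz⟩

/-- If `(m+1)(θ m - 1) → L` along a filter, then `θ m ^ (m+1) → exp L`. -/
theorem exp_of_lim (l : Filter ℕ) [l.NeBot] (hl : l ≤ atTop) (θ : ℕ → ℂ) (L x : ℂ)
    (hL : Tendsto (fun m : ℕ => ((m + 1 : ℕ) : ℂ) * (θ m - 1)) l (𝓝 L))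
    (hx : ∀ m, θ m ^ (m + 1) = x) : x = Complex.exp L := by
  have hinv : Tendsto (fun m : ℕ => (((m + 1 : ℕ) : ℂ))⁻¹) l (𝓝 0) := by
    have : Tendsto (fun m : ℕ => (((m + 1 : ℕ) : ℂ))⁻¹) atTop (𝓝 0) :=
      (tendsto_inv_atTop_nhds_zero_nat (𝕜 := ℂ)).comp (tendsto_add_atTop_nat 1)
    exact this.mono_left hl
  have hz : Tendsto (fun m => θ m - 1) l (𝓝 0) := by
    have := hinv.mul hL
    rw [zero_mul] at this
    refine this.congr fun m => ?_
    have : ((m + 1 : ℕ) : ℂ) ≠ 0 := by exact_mod_cast Nat.succ_ne_zero m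
    field_simp
  have hlog : Tendsto (fun m : ℕ => ((m + 1 : ℕ) : ℂ) * Complex.log (θ m)) l (𝓝 L) := by
    have hd : Tendsto (fun m : ℕ => ((m + 1 : ℕ) : ℂ) * Complex.log (θ m)
        - ((m + 1 : ℕ) : ℂ) * (θ m - 1)) l (𝓝 0) := by
      have hb : Tendsto (fun m : ℕ => ‖((m + 1 : ℕ) : ℂ) * (θ m - 1)‖ * ‖θ m - 1‖) l (𝓝 0) := by
        simpa using hL.norm.mul hz.norm
      refine squeeze_zero_norm' ?_ hb
      have hsm : ∀ᶠ m in l, ‖θ m - 1‖ < 1 / 2 := by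
        have := hz.norm
        rw [norm_zero] at this
        exact this.eventually_lt_const (by norm_num)
      filter_upwards [hsm] with m hm
      have h1 := Complex.norm_log_one_add_sub_self_le (z := θ m - 1) (by linarith)
      rw [add_sub_cancel] at h1
      rw [← mul_sub, norm_mul, norm_mul, mul_assoc]
      refine mul_le_mul_of_nonneg_left (h1.trans ?_) (norm_nonneg _)
      have h2 : (1 - ‖θ m - 1‖)⁻¹ ≤ 2 := by
        rw [inv_le_comm₀ (by linarith) (by norm_num)]
        linarith
      nlinarith [sq_nonneg ‖θ m - 1‖]
    simpa using hd.add hL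
  have he := (Complex.continuous_exp.tendsto L).comp hlog
  refine tendsto_nhds_unique (tendsto_const_nhds.congr' ?_) he
  have hne : ∀ᶠ m in l, θ m - 1 ≠ -1 := hz.eventually_ne (by norm_num)
  filter_upwards [hne] with m hm
  have : θ m ≠ 0 := by
    intro h
    exact hm (by simp [h])
  simp only [Function.comp]
  rw [Complex.exp_nat_mul, Complex.exp_log this, hx]

/-- Every infinitely divisible normalized positive definite function on a finite group is
of Poisson type (Parthasarathy's theorem). -/
theorem infinitely_divisible_posdef_fn_is_poisson
    {G : Type*} [Group G] [Fintype G] (φ : G → ℂ)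
    (hpd : IsPosDefFn φ) (hnorm : φ 1 = 1)
    (hdiv : ∀ n : ℕ, 0 < n →
      ∃ ψ : G → ℂ, IsPosDefFn ψ ∧ ψ 1 = 1 ∧ ∀ g, ψ g ^ n = φ g) :
    ∃ (H : Subgroup G) (r : ℝ) (v : G → ℂ),
      0 ≤ r ∧ IsPosDefFn v ∧ v 1 = 1 ∧
      (∀ g, g ∉ H → v g = 0) ∧
      (∀ g ∈ H, φ g = Complex.exp (r * (v g - 1))) ∧
      (∀ g, g ∉ H → φ g = 0) := by
  classical
  have hN : 0 < Fintype.card G := Fintype.card_pos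
  set N := Fintype.card G with hNdef
  choose ψ hψpd hψ1 hψ using fun m : ℕ => hdiv ((m + 1) * N) (by positivity)
  set l : Ultrafilter ℕ := Filter.hyperfilter ℕ with hldef
  have hl : (l : Filter ℕ) ≤ atTop := Nat.hyperfilter_le_atTop
  have hψle : ∀ m g, ‖ψ m g‖ ≤ 1 := fun m g => by
    have := (hψpd m).norm_le g
    simpa [hψ1 m] using this
  have hψ0 : ∀ m g, φ g = 0 → ψ m g = 0 := fun m g h => by
    have := hψ m g
    rw [h] at this
    exact pow_eq_zero_iff (by positivity) |>.1 this
  have hinv : Tendsto (fun m : ℕ => (((m + 1 : ℕ) : ℝ))⁻¹) l (𝓝 0) := by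
    have : Tendsto (fun m : ℕ => (((m + 1 : ℕ) : ℝ))⁻¹) atTop (𝓝 0) :=
      (tendsto_inv_atTop_nhds_zero_nat (𝕜 := ℝ)).comp (tendsto_add_atTop_nat 1)
    exact this.mono_left hl
  -- the powers
  set θ : ℕ → G → ℂ := fun m g => ψ m g ^ N with hθdef
  have hθpd : ∀ m, IsPosDefFn (θ m) := fun m => (hψpd m).pow N
  have hθ1 : ∀ m, θ m 1 = 1 := fun m => by simp [hθdef, hψ1]
  have hθpow : ∀ m g, θ m g ^ (m + 1) = φ g := fun m g => by
    rw [← hψ m g, hθdef, mul_comm, pow_mul]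
  have hlogθ : ∀ m g, φ g ≠ 0 → 1 - ‖θ m g‖ ^ 2 ≤ ((m + 1 : ℕ) : ℝ)⁻¹ * (-2 * Real.log ‖φ g‖) := by
    intro m g hg
    have h1 : ‖θ m g‖ ^ (m + 1) = ‖φ g‖ := by rw [← norm_pow, hθpow]
    have hne : 0 < ‖θ m g‖ := by
      rw [norm_pos_iff]
      intro h
      have := hθpow m g
      rw [h] at this
      simp at this
      exact hg this.symm
    have h2 := Real.log_le_sub_one_of_pos (pow_pos hne 2)
    have h3 : ((m + 1 : ℕ) : ℝ)⁻¹ * (-2 * Real.log ‖φ g‖) = -Real.log (‖θ m g‖ ^ 2) := by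
      rw [← h1, Real.log_pow, Real.log_pow]
      have : ((m + 1 : ℕ) : ℝ) ≠ 0 := by exact_mod_cast Nat.succ_ne_zero m
      field_simp
      push_cast
      ring
    rw [h3]
    linarith
  -- limit character
  choose χ hχ using fun g => ultra_lim l (fun m => ψ m g) 1 (Eventually.of_forall fun m => hψle m g)
  have hχpd : IsPosDefFn χ := IsPosDefFn.of_tendsto (Eventually.of_forall hψpd) hχ
  have hχ1 : χ 1 = 1 := by
    refine tendsto_nhds_unique (hχ 1) ?_
    simp only [hψ1]
    exact tendsto_const_nhds
  have hθχ : ∀ g, Tendsto (fun m => θ m g) l (𝓝 (χ g ^ N)) := fun g => (hχ g).pow N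
  have hχ0 : ∀ g, φ g = 0 → χ g = 0 := fun g h => by
    refine tendsto_nhds_unique (hχ g) ?_
    simp only [hψ0 _ g h]
    exact tendsto_const_nhds
  have hχn : ∀ g, φ g ≠ 0 → ‖χ g‖ = 1 := fun g h => by
    have h1 : ‖χ g‖ ≤ 1 := by simpa [hχ1] using hχpd.norm_le g
    have h2 : 1 - ‖χ g ^ N‖ ^ 2 ≤ 0 * (-2 * Real.log ‖φ g‖) :=
      le_of_tendsto_of_tendsto' (((hθχ g).norm.pow 2).const_sub 1)
        (hinv.mul_const _) (fun m => hlogθ m g h)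
    rw [zero_mul, norm_pow, ← pow_mul] at h2
    by_contra hne
    have := pow_lt_one₀ (norm_nonneg (χ g)) (lt_of_le_of_ne h1 hne)
      (show N * 2 ≠ 0 by positivity)
    linarith
  let H : Subgroup G :=
    { carrier := {g | φ g ≠ 0}
      one_mem' := by simp [hnorm]
      mul_mem' := by
        intro a b ha hb h0
        have h1 := hχpd.mul_eq hχ1 a b (hχn a ha)
        rw [hχ0 _ h0] at h1
        have h2 := congrArg norm h1
        rw [norm_mul, hχn a ha, hχn b hb] at h2
        simp at h2
      inv_mem' := by
        intro a ha h0
        rw [hpd.conj_inv] at h0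
        exact ha (by simpa using h0) }
  have hH : ∀ g, g ∈ H ↔ φ g ≠ 0 := fun g => Iff.rfl
  have hH0 : ∀ g, g ∉ H → φ g = 0 := fun g hg => by
    by_contra h
    exact hg ((hH g).2 h)
  have hχN : ∀ g ∈ H, χ g ^ N = 1 := by
    intro g hg
    have : ∀ k : ℕ, χ (g ^ k) = χ g ^ k := by
      intro k
      induction k with
      | zero => simp [hχ1]
      | succ k ih => rw [pow_succ', pow_succ', hχpd.mul_eq hχ1 _ _ (hχn g hg), ih]
    rw [← this, hNdef, pow_card_eq_one, hχ1]
  have hθ0 : ∀ m g, g ∉ H → θ m g = 0 := fun m g hg => by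
    simp only [hθdef, hψ0 m g (hH0 g hg)]
    exact zero_pow hN.ne'
  choose δ hδ0 hδpd hδb hδs using fun m => split_trivial H (θ m) (hθpd m) (hθ1 m) (hθ0 m)
  have hn := card_filter_pos H
  set S := Finset.univ.filter (· ∈ H) with hS
  have hδlim : Tendsto δ l (𝓝 0) := by
    have h1 : Tendsto (fun m => (S.card : ℝ)⁻¹ * ∑ g ∈ S, (1 - (θ m g).re)) l (𝓝 0) := by
      have : Tendsto (fun m => (S.card : ℝ)⁻¹ * ∑ g ∈ S, (1 - (θ m g).re)) l
          (𝓝 ((S.card : ℝ)⁻¹ * ∑ g ∈ S, (1 - (χ g ^ N).re))) :=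
        Tendsto.const_mul _ (tendsto_finsetSum _ fun g _ =>
          ((Complex.continuous_re.tendsto _).comp (hθχ g)).const_sub 1)
      rw [Finset.sum_eq_zero, mul_zero] at this
      · exact this
      · intro g hg
        rw [hχN g (by simpa [hS] using hg)]
        simp
    refine h1.congr fun m => ?_
    rw [← hδs m]
    have : (S.card : ℝ) ≠ 0 := by exact_mod_cast hn.ne'
    field_simp
  set C : ℝ := ∑ g ∈ S, (-2 * Real.log ‖φ g‖) with hC
  have hδC : ∀ᶠ m in (l : Filter ℕ), ((m + 1 : ℕ) : ℝ) * δ m ≤ C := by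
    filter_upwards [hδlim.eventually_lt_const (show (0:ℝ) < 1 / 4 by norm_num)] with m hm
    have h1 := delta_bound H (θ m) (δ m) hm.le (hδ0 m) (hδb m) (hδs m)
    have h2 : δ m ≤ ((m + 1 : ℕ) : ℝ)⁻¹ * C := by
      refine h1.trans ?_
      rw [hC, Finset.mul_sum]
      exact Finset.sum_le_sum fun g hg => hlogθ m g (by
        have : g ∈ H := by simpa [hS] using hg
        exact this)
    have hp : (0 : ℝ) < ((m + 1 : ℕ) : ℝ) := by positivity
    calc ((m + 1 : ℕ) : ℝ) * δ m ≤ ((m + 1 : ℕ) : ℝ) * (((m + 1 : ℕ) : ℝ)⁻¹ * C) :=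
          mul_le_mul_of_nonneg_left h2 hp.le
      _ = C := by field_simp
  have hLb : ∀ g, ∀ᶠ m in (l : Filter ℕ),
      ‖((m + 1 : ℕ) : ℂ) * (θ m g - ind H g)‖ ≤ 2 * C := by
    intro g
    filter_upwards [hδC] with m hm
    have hp : (0 : ℝ) ≤ ((m + 1 : ℕ) : ℝ) := by positivity
    have hC0 : 0 ≤ C := (mul_nonneg hp (hδ0 m)).trans hm
    by_cases hg : g ∈ H
    · have h1 := hδb m g hg
      have : ind H g = 1 := by simp [ind, hg]
      rw [this, norm_mul, norm_sub_rev, Complex.norm_natCast]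
      have := mul_le_mul_of_nonneg_left h1 hp
      linarith
    · simp [hθ0 m g hg, ind, hg, hC0]
  choose L hL using fun g => ultra_lim l _ _ (hLb g)
  have hC0 : 0 ≤ C := by
    obtain ⟨m, hm⟩ := hδC.exists
    exact (mul_nonneg (by positivity) (hδ0 m)).trans hm
  have hL1 : L 1 = 0 := by
    refine tendsto_nhds_unique (hL 1) ?_
    simp [hθ1, ind, H.one_mem]
  have hL0 : ∀ g, g ∉ H → L g = 0 := by
    intro g hg
    refine tendsto_nhds_unique (hL g) ?_
    simp [hθ0 _ g hg, ind, hg]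
  set r : ℝ := C + 1 with hr
  have hr0 : 0 < r := by linarith
  have hpdL : IsPosDefFn (fun g => L g + (r : ℂ) * ind H g) := by
    refine IsPosDefFn.of_tendsto (l := (l : Filter ℕ))
      (f := fun m g => ((m + 1 : ℕ) : ℂ) * (θ m g - ind H g) + (r : ℂ) * ind H g) ?_
      (fun g => (hL g).add_const _)
    filter_upwards [hδC] with m hm
    have hA := (hδpd m).smul ((m + 1 : ℕ) : ℝ) (by positivity)
    have hB := (ind_posDef H).smul (r - ((m + 1 : ℕ) : ℝ) * δ m) (by linarith)
    convert hA.add hB using 2 with g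
    push_cast
    ring
  have hrc : (r : ℂ) ≠ 0 := by exact_mod_cast hr0.ne'
  refine ⟨H, r, fun g => ((r⁻¹ : ℝ) : ℂ) * (L g + (r : ℂ) * ind H g), hr0.le,
    hpdL.smul r⁻¹ (by positivity), ?_, ?_, ?_, hH0⟩
  · simp [hL1, ind, H.one_mem, hrc]
  · intro g hg
    simp [hL0 g hg, ind, hg]
  · intro g hg
    have hi : ind H g = 1 := by simp [ind, hg]
    have h1 := hL g
    rw [hi] at h1
    rw [exp_of_lim l hl (fun m => θ m g) (L g) (φ g) h1 (fun m => hθpow m g)]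
    congr 1
    simp only [hi]
    push_cast
    field_simp
    ring
end
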